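/- Let X be a matching on [2n] with no left-nestings, and for 1 ≤ a ≤ 2n+1 let X'_a denote the matching on [2n+2] obtained from X by shifting all endpoints ≥ a up by one and adding the pair (a, 2n+2). Then X'_a has no left-nestings if and only if a-1 is not immediately to the left of a left endpoint of X'_a other than a; equivalently, X'_a has no left-nestings if and only if position a is immediately to the left of a right endpoint of the resulting diagram (including 2n+2 itself). In particular, exactly n+1 of the 2n+1 matchings X'_a have no left-nestings. -/

import Mathlib

open scoped Classical

/-- A matching on `[2n] = {1, …, 2n}`: a finite set of pairs `(a, b)` with `a < b`,
whose endpoints are exactly `{1, …, 2n}`, with all endpoints pairwise distinct. -/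
def IsMatching (n : ℕ) (X : Finset (ℕ × ℕ)) : Prop :=
  (∀ p ∈ X, p.1 < p.2) ∧
  (∀ i : ℕ, (1 ≤ i ∧ i ≤ 2 * n) ↔ ∃ p ∈ X, i = p.1 ∨ i = p.2) ∧
  (∀ p ∈ X, ∀ q ∈ X, p ≠ q → p.1 ≠ q.1 ∧ p.1 ≠ q.2 ∧ p.2 ≠ q.1 ∧ p.2 ≠ q.2)

/-- A left-nesting: pairs `(a, b), (c, d) ∈ X` with `a < c < d < b` and `c = a + 1`. -/
def HasLeftNesting (X : Finset (ℕ × ℕ)) : Prop :=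
  ∃ p ∈ X, ∃ q ∈ X, q.1 = p.1 + 1 ∧ q.1 < q.2 ∧ q.2 < p.2

/-- Insert a new arc `(a, M)`: shift all endpoints of `X` that are `≥ a` up by one and
add the pair `(a, M)`. -/
def insertArc (X : Finset (ℕ × ℕ)) (a M : ℕ) : Finset (ℕ × ℕ) :=
  (X.image fun p => (if a ≤ p.1 then p.1 + 1 else p.1, if a ≤ p.2 then p.2 + 1 else p.2))
    ∪ {(a, M)}

theorem mem_insertArc {X : Finset (ℕ × ℕ)} {a M : ℕ} {q : ℕ × ℕ} :
    q ∈ insertArc X a M ↔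
      (∃ p ∈ X, (if a ≤ p.1 then p.1 + 1 else p.1, if a ≤ p.2 then p.2 + 1 else p.2) = q) ∨
        q = (a, M) := by
  simp only [insertArc, Finset.mem_union, Finset.mem_image, Finset.mem_singleton]

theorem exists_mem_insertArc_fst_eq_succ {X : Finset (ℕ × ℕ)} {a M : ℕ} :
    (∃ p ∈ insertArc X a M, p.1 = a + 1) ↔ ∃ p ∈ X, p.1 = a := by
  constructor
  · rintro ⟨q, hq, h⟩
    rcases mem_insertArc.1 hq with ⟨p, hp, rfl⟩ | rfl
    · exact ⟨p, hp, by grind⟩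
    · simp at h
  · rintro ⟨p, hp, rfl⟩
    exact ⟨_, mem_insertArc.2 (Or.inl ⟨p, hp, rfl⟩), by simp⟩

theorem exists_mem_insertArc_snd_eq_succ {X : Finset (ℕ × ℕ)} {a M : ℕ} :
    (∃ p ∈ insertArc X a M, p.2 = a + 1) ↔ M = a + 1 ∨ ∃ p ∈ X, p.2 = a := by
  constructor
  · rintro ⟨q, hq, h⟩
    rcases mem_insertArc.1 hq with ⟨p, hp, rfl⟩ | rfl
    · exact Or.inr ⟨p, hp, by grind⟩
    · exact Or.inl h
  · rintro (rfl | ⟨p, hp, rfl⟩)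
    · exact ⟨_, mem_insertArc.2 (Or.inr rfl), rfl⟩
    · exact ⟨_, mem_insertArc.2 (Or.inl ⟨p, hp, rfl⟩), by simp⟩

namespace IsMatching

variable {n : ℕ} {X : Finset (ℕ × ℕ)}

theorem snd_le (hX : IsMatching n X) {p : ℕ × ℕ} (hp : p ∈ X) : p.2 ≤ 2 * n :=
  ((hX.2.1 p.2).2 ⟨p, hp, Or.inr rfl⟩).2

theorem fst_ne_snd (hX : IsMatching n X) {p q : ℕ × ℕ} (hp : p ∈ X) (hq : q ∈ X) :
    p.1 ≠ q.2 := by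
  by_cases h : p = q
  · exact h ▸ (hX.1 p hp).ne
  · exact (hX.2.2 p hp q hq h).2.1

theorem injOn_fst (hX : IsMatching n X) : Set.InjOn Prod.fst (X : Set (ℕ × ℕ)) :=
  fun p hp q hq h => by_contra fun hne => (hX.2.2 p hp q hq hne).1 h

theorem injOn_snd (hX : IsMatching n X) : Set.InjOn Prod.snd (X : Set (ℕ × ℕ)) :=
  fun p hp q hq h => by_contra fun hne => (hX.2.2 p hp q hq hne).2.2.2 h

theorem card_eq (hX : IsMatching n X) : X.card = n := by
  have hdisj : Disjoint (X.image Prod.fst) (X.image Prod.snd) := by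
    simp only [Finset.disjoint_left, Finset.mem_image]
    rintro _ ⟨p, hp, rfl⟩ ⟨q, hq, h⟩
    exact hX.fst_ne_snd hp hq h.symm
  have hunion : X.image Prod.fst ∪ X.image Prod.snd = Finset.Icc 1 (2 * n) := by
    ext i
    rw [Finset.mem_Icc, hX.2.1 i]
    simp only [Finset.mem_union, Finset.mem_image]
    grind
  have h := Finset.card_union_of_disjoint hdisj
  rw [hunion, Nat.card_Icc, Finset.card_image_of_injOn hX.injOn_fst,
    Finset.card_image_of_injOn hX.injOn_snd] at h
  omega

theorem hasLeftNesting_insertArc_iff (hX : IsMatching n X) (hno : ¬ HasLeftNesting X) (a : ℕ) :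
    HasLeftNesting (insertArc X a (2 * n + 2)) ↔ ∃ p ∈ X, p.1 = a := by
  constructor
  · rintro ⟨p', hp', q', hq', h⟩
    rcases mem_insertArc.1 hq' with ⟨q, hq, rfl⟩ | rfl
    · rcases mem_insertArc.1 hp' with ⟨p, hp, rfl⟩ | rfl
      · refine absurd ⟨p, hp, q, hq, ?_, hX.1 q hq, by grind⟩ hno
        have hne : p.1 ≠ q.1 := fun he => by
          rw [hX.injOn_fst hp hq he] at h
          omega
        grind
      · exact ⟨q, hq, by grind⟩
    · rcases mem_insertArc.1 hp' with ⟨p, hp, rfl⟩ | rfl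
      · have := hX.snd_le hp
        grind
      · omega
  · rintro ⟨p, hp, rfl⟩
    have hlt := hX.1 p hp
    have hle := hX.snd_le hp
    refine ⟨_, mem_insertArc.2 (Or.inr rfl), _, mem_insertArc.2 (Or.inl ⟨p, hp, rfl⟩), ?_⟩
    grind

theorem not_exists_fst_eq_iff (hX : IsMatching n X) {a : ℕ} (h1 : 1 ≤ a) (h2 : a ≤ 2 * n + 1) :
    (¬ ∃ p ∈ X, p.1 = a) ↔ 2 * n + 2 = a + 1 ∨ ∃ p ∈ X, p.2 = a := by
  constructor
  · intro h
    by_cases ha : a ≤ 2 * n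
    · obtain ⟨p, hp, rfl | rfl⟩ := (hX.2.1 a).1 ⟨h1, ha⟩
      · exact absurd ⟨p, hp, rfl⟩ h
      · exact Or.inr ⟨p, hp, rfl⟩
    · left
      omega
  · rintro h ⟨p, hp, rfl⟩
    rcases h with h | ⟨q, hq, h⟩
    · have := hX.1 p hp
      have := hX.snd_le hp
      omega
    · exact hX.fst_ne_snd hp hq h.symm

end IsMatching

/-- Let `X` be a matching on `[2n]` with no left-nestings and for `1 ≤ a ≤ 2n+1` let
`X'_a = insertArc X a (2n+2)`.  Then `X'_a` has no left-nestings iff `a` is not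
immediately to the left of a left endpoint of `X'_a` (other than `a` itself);
equivalently, iff position `a` is immediately to the left of a right endpoint of
`X'_a` (including `2n+2` itself).  In particular, exactly `n + 1` of the `2n + 1`
matchings `X'_a` have no left-nestings. -/
theorem insertArc_no_left_nesting_iff (n : ℕ) (X : Finset (ℕ × ℕ))
    (hX : IsMatching n X) (hno : ¬ HasLeftNesting X) :
    (∀ a : ℕ, 1 ≤ a → a ≤ 2 * n + 1 →
      ((¬ HasLeftNesting (insertArc X a (2 * n + 2)) ↔
          ¬ ∃ p ∈ insertArc X a (2 * n + 2), p.1 = a + 1) ∧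
       (¬ HasLeftNesting (insertArc X a (2 * n + 2)) ↔
          ∃ p ∈ insertArc X a (2 * n + 2), p.2 = a + 1))) ∧
    ((Finset.Icc 1 (2 * n + 1)).filter fun a =>
        ¬ HasLeftNesting (insertArc X a (2 * n + 2))).card = n + 1 := by
  have key : ∀ a, 1 ≤ a → a ≤ 2 * n + 1 → (¬ HasLeftNesting (insertArc X a (2 * n + 2)) ↔
      2 * n + 2 = a + 1 ∨ ∃ p ∈ X, p.2 = a) := fun a h1 h2 => by
    rw [hX.hasLeftNesting_insertArc_iff hno, hX.not_exists_fst_eq_iff h1 h2]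
  refine ⟨fun a h1 h2 => ⟨?_, ?_⟩, ?_⟩
  · rw [hX.hasLeftNesting_insertArc_iff hno, exists_mem_insertArc_fst_eq_succ]
  · rw [key a h1 h2, exists_mem_insertArc_snd_eq_succ]
  · have hfilter : ((Finset.Icc 1 (2 * n + 1)).filter fun a =>
        ¬ HasLeftNesting (insertArc X a (2 * n + 2))) =
          insert (2 * n + 1) (X.image Prod.snd) := by
      ext a
      simp only [Finset.mem_filter, Finset.mem_Icc, Finset.mem_insert, Finset.mem_image]
      constructor
      · rintro ⟨⟨h1, h2⟩, h⟩
        exact ((key a h1 h2).1 h).imp_left (by omega)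
      · intro h
        have ha : 1 ≤ a ∧ a ≤ 2 * n + 1 := by
          rcases h with rfl | ⟨p, hp, rfl⟩
          · omega
          · have := hX.1 p hp
            have := hX.snd_le hp
            omega
        exact ⟨ha, (key a ha.1 ha.2).2 (h.imp_left (by omega))⟩
    rw [hfilter, Finset.card_insert_of_notMem, Finset.card_image_of_injOn hX.injOn_snd,
      hX.card_eq]
    simp only [Finset.mem_image, not_exists, not_and]
    intro p hp h
    have := hX.snd_le hp
    omega
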